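/- arXiv:2304.13823 — 2 statements merged into one kernel-verified Lean document; each statement's English description precedes it below -/
import Mathlib

section
/- Let n ≥ 0, let a_0,…,a_{n+1} be positive integers and d a positive integer with d ≠ a_j for every j. Let T be a finite set of exponent vectors m ∈ ℕ^{n+2}, each of weighted degree d (i.e. Σ_j a_j m_j = d for all m ∈ T). Suppose there exists a nonempty subset I ⊆ {0,…,n+1}, with |I| = k, such that both of the following fail: (a) there is no m ∈ T supported in I (i.e. every m ∈ T has m_j > 0 for some j ∉ I); and (b) the set S := { j ∉ I : there exists m ∈ T with m_j = 1 and m supported in I ∪ {j} } has cardinality strictly less than k. Then for every polynomial f ∈ ℂ[x_0,…,x_{n+1}] that is a ℂ-linear combination of the monomials x^m with m ∈ T, there exists a point x ∈ ℂ^{n+2} with x ≠ 0 such that f(x) = 0 and all partial derivatives ∂f/∂x_j vanish at x. -/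
open MvPolynomial in
lemma qs_height_origin (N : ℕ) :
    (N : ℕ∞) ≤ (vanishingIdeal ℂ {(0 : Fin N → ℂ)} : Ideal (MvPolynomial (Fin N) ℂ)).height := by
  have h1 : ringKrullDim (MvPolynomial (Fin N) ℂ) = N := by
    rw [MvPolynomial.ringKrullDim_of_isNoetherianRing, ringKrullDim_eq_zero_of_field]
    simp
  have h2 : ringKrullDim (MvPolynomial (Fin N) ℂ) ≤
      ((vanishingIdeal ℂ {(0 : Fin N → ℂ)} : Ideal (MvPolynomial (Fin N) ℂ)).height :
        WithBot ℕ∞) := by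
    rw [ringKrullDim_le_iff_isMaximal_height_le]
    intro m hm
    obtain ⟨y, rfl⟩ := isMaximal_iff_eq_vanishingIdeal_singleton.1 hm
    let φ : (Fin N → ℂ) → (MvPolynomial (Fin N) ℂ →ₐ[ℂ] MvPolynomial (Fin N) ℂ) :=
      fun z => aeval fun i => X i + C (z i)
    have hφ : ∀ z, (φ z).comp (φ (-z)) = AlgHom.id ℂ _ := by
      intro z
      ext i
      simp [φ, algHom_C]
    let e : MvPolynomial (Fin N) ℂ ≃ₐ[ℂ] MvPolynomial (Fin N) ℂ :=
      AlgEquiv.ofAlgHom (φ y) (φ (-y)) (hφ y) (by simpa using hφ (-y))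
    have he : (vanishingIdeal ℂ {y} : Ideal (MvPolynomial (Fin N) ℂ)) =
        (vanishingIdeal ℂ {(0 : Fin N → ℂ)}).comap (e.toRingEquiv) := by
      ext p
      rw [Ideal.mem_comap, mem_vanishingIdeal_singleton_iff, mem_vanishingIdeal_singleton_iff]
      have : (aeval (0 : Fin N → ℂ)).comp (φ y) = aeval y := by
        ext i
        simp [φ]
      rw [← this]
      rfl
    rw [he, RingEquiv.height_comap]
  rw [h1] at h2
  exact_mod_cast h2

open MvPolynomial in
lemma qs_exists_zero (N : ℕ) (s : Finset (MvPolynomial (Fin N) ℂ)) (hs : s.card < N)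
    (h0 : ∀ p ∈ s, eval 0 p = 0) : ∃ x : Fin N → ℂ, x ≠ 0 ∧ ∀ p ∈ s, eval x p = 0 := by
  by_contra! hcon
  have hz : zeroLocus ℂ (Ideal.span (s : Set (MvPolynomial (Fin N) ℂ))) = {0} := by
    rw [zeroLocus_span]
    ext x
    simp only [Set.mem_ofPred_eq, Set.mem_singleton_iff]
    constructor
    · intro h
      by_contra hx
      obtain ⟨p, hp, hp'⟩ := hcon x hx
      exact hp' (by simpa [aeval_eq_eval] using h p hp)
    · rintro rfl p hp
      simpa [aeval_eq_eval] using h0 p hp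
  have hr := vanishingIdeal_zeroLocus_eq_radical (k := ℂ) (K := ℂ)
    (Ideal.span (s : Set (MvPolynomial (Fin N) ℂ)))
  rw [hz] at hr
  have hm : (vanishingIdeal ℂ {(0 : Fin N → ℂ)} : Ideal (MvPolynomial (Fin N) ℂ)) ∈
      (Ideal.span (s : Set (MvPolynomial (Fin N) ℂ))).minimalPrimes := by
    refine ⟨⟨inferInstance, hr ▸ Ideal.le_radical⟩, ?_⟩
    rintro q ⟨hq, hsq⟩ -
    rw [hr]
    exact hq.radical_le_iff.2 hsq
  have := (qs_height_origin N).trans (Ideal.height_le_card_of_mem_minimalPrimes_span_finset hm)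
  have : N ≤ s.card := by exact_mod_cast this
  omega

open MvPolynomial in
lemma qs_eval_pderiv {N : ℕ} (f : MvPolynomial (Fin N) ℂ) (x : Fin N → ℂ) (j : Fin N)
    (h : ∀ m ∈ f.support, m j ≠ 0 → ∃ l, x l = 0 ∧ (m - Finsupp.single j 1 : Fin _ →₀ ℕ) l ≠ 0) :
    eval x (pderiv j f) = 0 := by
  rw [f.as_sum, map_sum, map_sum]
  refine Finset.sum_eq_zero fun m hm => ?_
  rw [pderiv_monomial, eval_monomial]
  by_cases hj : m j = 0
  · simp [hj]
  obtain ⟨l, hl, hl'⟩ := h m hm hj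
  refine mul_eq_zero_of_right _ ?_
  exact Finset.prod_eq_zero (Finsupp.mem_support_iff.2 hl') (by beta_reduce; rw [hl]; exact zero_pow hl')



open scoped Classical in
/-- Converse direction of the quasismoothness criterion: if for some nonempty index set
`I` both conditions of the criterion fail — (a) no exponent vector of `T` is supported
in `I`, and (b) the set `S` of indices `j ∉ I` admitting a monomial `x^m`, `m ∈ T`, with
`m j = 1` and `m` supported in `I ∪ {j}` has fewer than `|I|` elements — then every
linear combination of the monomials `x^m`, `m ∈ T`, has a nonzero singular point on its
affine cone. -/
theorem not_quasismooth_of_criterion_fails (n : ℕ)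
    (a : Fin (n + 2) → ℕ) (ha : ∀ j, 0 < a j)
    (d : ℕ) (hd : 0 < d) (hda : ∀ j, d ≠ a j)
    (T : Finset (Fin (n + 2) →₀ ℕ))
    (hdeg : ∀ m ∈ T, ∑ j, a j * m j = d)
    (I : Finset (Fin (n + 2))) (hI : I.Nonempty)
    (hfail_a : ∀ m ∈ T, ∃ j, j ∉ I ∧ 0 < m j)
    (hfail_b :
      (Finset.univ.filter fun j =>
          j ∉ I ∧ ∃ m ∈ T, m j = 1 ∧ ∀ l, l ∉ I → l ≠ j → m l = 0).card < I.card) :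
    ∀ f : MvPolynomial (Fin (n + 2)) ℂ, f.support ⊆ T →
      ∃ x : Fin (n + 2) → ℂ, x ≠ 0 ∧ MvPolynomial.eval x f = 0 ∧
        ∀ j, MvPolynomial.eval x (MvPolynomial.pderiv j f) = 0 := by
  intro f hf
  set S := Finset.univ.filter fun j =>
          j ∉ I ∧ ∃ m ∈ T, m j = 1 ∧ ∀ l, l ∉ I → l ≠ j → m l = 0 with hS
  let s : Finset (MvPolynomial (Fin (n + 2)) ℂ) :=
    S.image (fun j => MvPolynomial.pderiv j f) ∪ Iᶜ.image MvPolynomial.X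
  have hcard : s.card < n + 2 := by
    have h1 : s.card ≤ S.card + Iᶜ.card :=
      (Finset.card_union_le _ _).trans (add_le_add Finset.card_image_le Finset.card_image_le)
    have h2 := Finset.card_add_card_compl I
    rw [Fintype.card_fin] at h2
    omega
  have h0 : ∀ p ∈ s, MvPolynomial.eval 0 p = 0 := by
    intro p hp
    rcases Finset.mem_union.1 hp with hp | hp
    · obtain ⟨j, -, rfl⟩ := Finset.mem_image.1 hp
      refine qs_eval_pderiv f 0 j fun m hm hmj => ?_
      by_contra! hcon
      have hz : ∀ l, (m - Finsupp.single j 1 : Fin _ →₀ ℕ) l = 0 := fun l => hcon l rfl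
      have hmm : m = Finsupp.single j 1 := by
        ext l
        have := hz l
        by_cases hl : l = j
        · subst hl
          simp at this ⊢
          omega
        · simpa [Finsupp.single_apply, Ne.symm hl] using this
      have := hdeg m (hf hm)
      rw [hmm] at this
      simp [Finsupp.single_apply] at this
      exact hda j this.symm
    · obtain ⟨j, -, rfl⟩ := Finset.mem_image.1 hp
      simp
  obtain ⟨x, hx0, hx⟩ := qs_exists_zero (n + 2) s hcard h0
  have hxI : ∀ l, l ∉ I → x l = 0 := by
    intro l hl
    simpa using hx (MvPolynomial.X l) (Finset.mem_union_right _
      (Finset.mem_image_of_mem _ (Finset.mem_compl.2 hl)))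
  refine ⟨x, hx0, ?_, ?_⟩
  · rw [MvPolynomial.eval_eq']
    refine Finset.sum_eq_zero fun m hm => mul_eq_zero_of_right _ ?_
    obtain ⟨l, hl, hml⟩ := hfail_a m (hf hm)
    exact Finset.prod_eq_zero (Finset.mem_univ l) (by simp [hxI l hl, hml.ne'])
  · intro j
    by_cases hjS : j ∈ S
    · exact hx _ (Finset.mem_union_left _ (Finset.mem_image_of_mem _ hjS))
    refine qs_eval_pderiv f x j fun m hm hmj => ?_
    obtain ⟨l, hl, hml⟩ := hfail_a m (hf hm)
    by_contra! hcon
    have hz : ∀ l, l ∉ I → (m - Finsupp.single j 1 : Fin _ →₀ ℕ) l = 0 := fun l hl => hcon l (hxI l hl)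
    have hoff : ∀ l, l ∉ I → l ≠ j → m l = 0 := by
      intro l hl hlj
      simpa [Finsupp.single_apply, hlj.symm] using hz l hl
    have hlj : l = j := by
      by_contra h
      have := hoff l hl h
      omega
    subst hlj
    have h1 := hz l hl
    simp at h1
    exact hjS (by simpa [hS] using ⟨hl, m, hf hm, by omega, hoff⟩)
end

section
/- Let f = x_0^2 + x_1^3·x_3 + x_1·x_2^5 + x_2·x_3^{19} ∈ ℂ[x_0, x_1, x_2, x_3]. If a point x ∈ ℂ^4 satisfies ∂f/∂x_i(x) = 0 for all i = 0, 1, 2, 3, then x = 0. (Hence the hypersurface {f = 0} of degree 22 in ℙ(11, 7, 3, 1) is quasismooth.) -/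
open MvPolynomial

/-- The only common zero of the partial derivatives of
`f = x₀² + x₁³x₃ + x₁x₂⁵ + x₂x₃¹⁹` is the origin; hence the degree-22 hypersurface
`{f = 0} ⊂ ℙ(11,7,3,1)` is quasismooth. -/
theorem dim2_example_quasismooth
    (f : MvPolynomial (Fin 4) ℂ)
    (hf : f = X 0 ^ 2 + X 1 ^ 3 * X 3 + X 1 * X 2 ^ 5 + X 2 * X 3 ^ 19) :
    ∀ x : Fin 4 → ℂ, (∀ i, MvPolynomial.eval x (MvPolynomial.pderiv i f) = 0) →
      x = 0 := by
  intro x h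
  have h0 := h 0
  have h1 := h 1
  have h2 := h 2
  have h3 := h 3
  simp [hf, pderiv_X, Pi.single_apply, Derivation.leibniz, Derivation.leibniz_pow] at h0 h1 h2 h3
  have e1 : 3 * x 1 ^ 2 * x 3 + x 2 ^ 5 = 0 := by linear_combination h1
  have e2 : 5 * x 1 * x 2 ^ 4 + x 3 ^ 19 = 0 := by linear_combination h2
  have e3 : x 1 ^ 3 + 19 * x 2 * x 3 ^ 18 = 0 := by linear_combination h3
  have hA : x 1 ^ 3 * x 3 = 0 := by
    linear_combination (1 / 286 : ℂ) * (x 3 * e3 - 19 * (x 2 * e2) + 95 * (x 1 * e1))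
  have key : x 1 = 0 ∧ x 2 = 0 ∧ x 3 = 0 := by
    rcases mul_eq_zero.mp hA with h | h
    · have a : x 1 = 0 := by simpa using h
      simp [a] at e1 e2
      exact ⟨a, e1, e2⟩
    · simp [h] at e1 e3
      exact ⟨e3, e1, h⟩
  obtain ⟨a, b, c⟩ := key
  ext i
  fin_cases i <;> simp [h0, a, b, c]
end
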